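/- For all real numbers a, b, x, y, as s → 0 through positive values, the conjugated matrices r₁(s)·M_HP(a,b,x,y)·r₁(s)^{−1} converge to the 4×4 real matrix whose rows are (1, 0, 0, 0), (0, 1, 0, 0), (b, b, 1, 0), and (a, −a, 0, 1). -/

import Mathlib

open Filter Topology

/-- The half-pipe holonomy matrix `M_HP(a,b,x,y)`. -/
noncomputable def MHP (a b x y : ℝ) : Matrix (Fin 4) (Fin 4) ℝ :=
  !![1 + a ^ 2 / 2, -(a ^ 2 / 2), a, 0;
     a ^ 2 / 2, 1 - a ^ 2 / 2, a, 0;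
     a, -a, 1, 0;
     -b - a ^ 2 * b + 2 * a * y + x, -b + a ^ 2 * b - 2 * a * y - x, 2 * y - 2 * a * b, 1]

/-- The rescaling matrix `r₁(s)` deforming half-pipe geometry to Sol geometry. -/
noncomputable def r1 (s : ℝ) : Matrix (Fin 4) (Fin 4) ℝ :=
  !![(s + s⁻¹) / 2, (s - s⁻¹) / 2, 0, 0;
     (s - s⁻¹) / 2, (s + s⁻¹) / 2, 0, 0;
     0, 0, 0, -s;
     0, 0, s⁻¹, 0]

/-- The determinant of the rescaling matrix is `1`. -/
theorem det_r1 {s : ℝ} (hs : s ≠ 0) : (r1 s).det = 1 := by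
  simp [r1, Matrix.det_succ_row_zero, Fin.sum_univ_succ, Fin.succAbove]
  field_simp
  ring

/-- Conjugating `MHP` by `r1 s` gives the Sol holonomy matrix plus an error of order `s ^ 2`. -/
theorem r1_conj_MHP (a b x y : ℝ) {s : ℝ} (hs : s ≠ 0) :
    r1 s * MHP a b x y * (r1 s)⁻¹ =
      !![(1 : ℝ), 0, 0, 0;
         0, 1, 0, 0;
         b, b, 1, 0;
         a, -a, 0, 1] +
      s ^ 2 • !![a ^ 2 / 2, -(a ^ 2 / 2), 0, a;
         a ^ 2 / 2, -(a ^ 2 / 2), 0, a;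
         a ^ 2 * b - 2 * a * y - x, -(a ^ 2 * b - 2 * a * y - x), 0, 2 * a * b - 2 * y;
         0, 0, 0, 0] := by
  have hdet : IsUnit (r1 s).det := by simp [det_r1 hs]
  rw [← Matrix.mul_nonsing_inv_cancel_right (r1 s) (_ + _) hdet]
  congr 1
  ext i j
  fin_cases i <;> fin_cases j <;>
    simp [r1, MHP, Matrix.mul_apply, Fin.sum_univ_succ] <;> field_simp <;> ring

/-- As `s → 0⁺`, the conjugates `r₁(s)·M_HP(a,b,x,y)·r₁(s)⁻¹` converge to the Sol holonomy
matrix with rows `(1,0,0,0)`, `(0,1,0,0)`, `(b,b,1,0)`, `(a,-a,0,1)`. -/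
theorem r1_conj_MHP_tendsto_sol (a b x y : ℝ) :
    Tendsto (fun s : ℝ => r1 s * MHP a b x y * (r1 s)⁻¹) (𝓝[>] 0)
      (𝓝 !![(1 : ℝ), 0, 0, 0;
            0, 1, 0, 0;
            b, b, 1, 0;
            a, -a, 0, 1]) := by
  have hlim (A B : Matrix (Fin 4) (Fin 4) ℝ) :
      Tendsto (fun s : ℝ => A + s ^ 2 • B) (𝓝[>] 0) (𝓝 A) := by
    have hcont : Continuous fun s : ℝ => A + s ^ 2 • B := by fun_prop
    simpa using (hcont.tendsto 0).mono_left nhdsWithin_le_nhds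
  have heq := (eventually_mem_nhdsWithin (a := (0 : ℝ))).mono fun (s : ℝ) (hs : s ∈ Set.Ioi 0) =>
    r1_conj_MHP a b x y (ne_of_gt hs)
  exact (tendsto_congr' heq).mpr (hlim _ _)
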